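/- Let n ≥ 1 be an integer, 1 ≤ p < ∞ and 0 < β < n, and write L^{p,β}_{0,∞,*} = L^{p,β}_0 ∩ L^{p,β}_∞ ∩ L^{p,β}_*. Then the chain of inclusions L^{p,β}_{0,∞,*}(ℝⁿ) ⊂ L^{p,β}_0(ℝⁿ) ∩ L^{p,β}_∞(ℝⁿ) ⊂ L^{p,β}_0(ℝⁿ) ⊂ L^{p,β}(ℝⁿ) holds and each inclusion is strict: there exist f₁ ∈ (L^{p,β}_0 ∩ L^{p,β}_∞) \ L^{p,β}_*, f₂ ∈ L^{p,β}_0 \ L^{p,β}_∞, and f₃ ∈ L^{p,β} \ L^{p,β}_0. -/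

import Mathlib

open MeasureTheory Metric ENNReal Filter

noncomputable def morreyA (n : ℕ) (p β : ℝ)
    (f : EuclideanSpace ℝ (Fin n) → ℂ)
    (y : EuclideanSpace ℝ (Fin n)) (r : ℝ) : ℝ≥0∞ :=
  ENNReal.ofReal (r ^ (-β)) * ∫⁻ x in ball y r, (‖f x‖₊ : ℝ≥0∞) ^ p

/-- The (global) Morrey norm `‖f‖_{L^{p,β}}`. -/
noncomputable def morreyNorm (n : ℕ) (p β : ℝ)
    (f : EuclideanSpace ℝ (Fin n) → ℂ) : ℝ≥0∞ :=
  ⨆ (y : EuclideanSpace ℝ (Fin n)) (r : ℝ) (_ : 0 < r),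
    (morreyA n p β f y r) ^ (1 / p)

/-- Membership in the vanishing-at-origin subspace `L^{p,β}_0`. -/
def vanishAtOrigin (n : ℕ) (p β : ℝ) (f : EuclideanSpace ℝ (Fin n) → ℂ) : Prop :=
  Tendsto
    (fun t : ℝ => ⨆ (y : EuclideanSpace ℝ (Fin n)) (r : ℝ) (_ : 0 < r) (_ : r ≤ t),
      morreyA n p β f y r)
    (nhdsWithin 0 (Set.Ioi 0)) (nhds 0)

/-- Membership in the vanishing-at-infinity subspace `L^{p,β}_∞`. -/
def vanishAtInfinity (n : ℕ) (p β : ℝ) (f : EuclideanSpace ℝ (Fin n) → ℂ) : Prop :=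
  Tendsto
    (fun t : ℝ => ⨆ (y : EuclideanSpace ℝ (Fin n)) (r : ℝ) (_ : t ≤ r),
      morreyA n p β f y r)
    atTop (nhds 0)

/-- Membership in the truncation subspace `L^{p,β}_*`. -/
def vanishTrunc (n : ℕ) (p β : ℝ) (f : EuclideanSpace ℝ (Fin n) → ℂ) : Prop :=
  Tendsto
    (fun N : ℝ => ⨆ (y : EuclideanSpace ℝ (Fin n)) (r : ℝ) (_ : 0 < r),
      ENNReal.ofReal (r ^ (-β)) *
        ∫⁻ x in ball y r ∩ {x : EuclideanSpace ℝ (Fin n) | N < ‖x‖},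
          (‖f x‖₊ : ℝ≥0∞) ^ p)
    atTop (nhds 0)

/-- The Morrey space `L^{p,β}(ℝⁿ)`, as a set of measurable functions with finite Morrey norm. -/
def MorreySet (n : ℕ) (p β : ℝ) : Set (EuclideanSpace ℝ (Fin n) → ℂ) :=
  {f | Measurable f ∧ morreyNorm n p β f < ⊤}

lemma ofReal_rpow_neg_mul_volume_ball (n : ℕ) (β : ℝ) (y : EuclideanSpace ℝ (Fin n)) {r : ℝ}
    (hr : 0 < r) :
    ENNReal.ofReal (r ^ (-β)) * volume (ball y r) =
      ENNReal.ofReal (r ^ ((n : ℝ) - β)) * volume (ball (0 : EuclideanSpace ℝ (Fin n)) 1) := by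
  rw [Measure.addHaar_ball_of_pos _ _ hr, finrank_euclideanSpace_fin, ← mul_assoc,
    ← ENNReal.ofReal_mul (by positivity), ← Real.rpow_natCast, ← Real.rpow_add hr,
    neg_add_eq_sub]

lemma morreyNorm_lt_top {n : ℕ} {p β : ℝ} (hp : 0 ≤ p) {f : EuclideanSpace ℝ (Fin n) → ℂ}
    {C : ℝ≥0∞} (hC : C ≠ ⊤) (h : ∀ y r, 0 < r → morreyA n p β f y r ≤ C) :
    morreyNorm n p β f < ⊤ := by
  have hp' : 0 ≤ 1 / p := by positivity
  refine lt_of_le_of_lt ?_ (ENNReal.rpow_lt_top_of_nonneg hp' hC)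
  exact iSup_le fun y => iSup_le fun r => iSup_le fun hr => ENNReal.rpow_le_rpow (h y r hr) hp'

lemma morreyA_le_of_norm_le_one {n : ℕ} {p β : ℝ} (hp : 0 ≤ p)
    {f : EuclideanSpace ℝ (Fin n) → ℂ} (hf : ∀ x, ‖f x‖ ≤ 1)
    (y : EuclideanSpace ℝ (Fin n)) {r : ℝ} (hr : 0 < r) :
    morreyA n p β f y r ≤
      ENNReal.ofReal (r ^ ((n : ℝ) - β)) * volume (ball (0 : EuclideanSpace ℝ (Fin n)) 1) := by
  rw [← ofReal_rpow_neg_mul_volume_ball n β y hr, morreyA]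
  gcongr
  calc ∫⁻ x in ball y r, (‖f x‖₊ : ℝ≥0∞) ^ p ≤ ∫⁻ _ in ball y r, 1 := by
        refine lintegral_mono fun x => ENNReal.rpow_le_one ?_ hp
        exact_mod_cast hf x
    _ = volume (ball y r) := setLIntegral_one _

lemma vanishAtOrigin_of_norm_le_one {n : ℕ} {p β : ℝ} (hp : 0 ≤ p) (hβn : β < n)
    {f : EuclideanSpace ℝ (Fin n) → ℂ} (hf : ∀ x, ‖f x‖ ≤ 1) : vanishAtOrigin n p β f := by
  have hlim : Tendsto (fun t : ℝ => ENNReal.ofReal (t ^ ((n : ℝ) - β)) *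
      volume (ball (0 : EuclideanSpace ℝ (Fin n)) 1)) (nhdsWithin 0 (Set.Ioi 0)) (nhds 0) := by
    have h1 : Tendsto (fun t : ℝ => t ^ ((n : ℝ) - β)) (nhdsWithin 0 (Set.Ioi 0)) (nhds 0) := by
      have := (Real.continuousAt_rpow_const 0 ((n : ℝ) - β) (Or.inr (by linarith))).tendsto
      rw [Real.zero_rpow (by linarith)] at this
      exact this.mono_left nhdsWithin_le_nhds
    have h2 := ENNReal.Tendsto.mul_const (b := volume (ball (0 : EuclideanSpace ℝ (Fin n)) 1))
      (ENNReal.tendsto_ofReal h1) (Or.inr measure_ball_lt_top.ne)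
    simpa using h2
  refine tendsto_of_tendsto_of_tendsto_of_le_of_le tendsto_const_nhds hlim (fun _ => zero_le) ?_
  intro t
  refine iSup_le fun y => iSup_le fun r => iSup_le fun hr => iSup_le fun hrt => ?_
  refine (morreyA_le_of_norm_le_one hp hf y hr).trans ?_
  beta_reduce
  gcongr

lemma vanishAtInfinity_of_lintegral_le {n : ℕ} {p β b : ℝ} (hb : b < β)
    {f : EuclideanSpace ℝ (Fin n) → ℂ} {C : ℝ≥0∞} (hC : C ≠ ⊤)
    (h : ∀ y r, 1 ≤ r → ∫⁻ x in ball y r, (‖f x‖₊ : ℝ≥0∞) ^ p ≤ ENNReal.ofReal (r ^ b) * C) :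
    vanishAtInfinity n p β f := by
  have hlim : Tendsto (fun t : ℝ => ENNReal.ofReal (t ^ (-(β - b))) * C) atTop (nhds 0) := by
    have h2 := ENNReal.Tendsto.mul_const (b := C)
      (ENNReal.tendsto_ofReal (tendsto_rpow_neg_atTop (sub_pos.2 hb))) (Or.inr hC)
    simpa using h2
  refine tendsto_of_tendsto_of_tendsto_of_le_of_le' tendsto_const_nhds hlim
    (Eventually.of_forall fun _ => zero_le) ?_
  filter_upwards [eventually_ge_atTop 1] with t ht
  refine iSup_le fun y => iSup_le fun r => iSup_le fun hrt => ?_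
  have hr : 0 < r := by linarith
  calc morreyA n p β f y r
      ≤ ENNReal.ofReal (r ^ (-β)) * (ENNReal.ofReal (r ^ b) * C) := by
        rw [morreyA]; gcongr; exact h y r (ht.trans hrt)
    _ = ENNReal.ofReal (r ^ (-(β - b))) * C := by
        rw [← mul_assoc, ← ENNReal.ofReal_mul (by positivity), ← Real.rpow_add hr]
        ring_nf
    _ ≤ ENNReal.ofReal (t ^ (-(β - b))) * C := by
        gcongr ENNReal.ofReal ?_ * C
        exact Real.rpow_le_rpow_of_nonpos (by linarith) hrt (by linarith)

lemma lintegral_ball_zero_norm_rpow (n : ℕ) (s : ℝ) {R : ℝ} (hR : 0 < R) :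
    ∫⁻ x in ball (0 : EuclideanSpace ℝ (Fin n)) R, ENNReal.ofReal (‖x‖ ^ s) =
      ENNReal.ofReal (R ^ ((n : ℝ) + s)) *
        ∫⁻ x in ball (0 : EuclideanSpace ℝ (Fin n)) 1, ENNReal.ofReal (‖x‖ ^ s) := by
  have hmeas : Measurable fun x : EuclideanSpace ℝ (Fin n) => ENNReal.ofReal (‖x‖ ^ s) := by
    fun_prop
  set G := (ball (0 : EuclideanSpace ℝ (Fin n)) R).indicator fun x => ENNReal.ofReal (‖x‖ ^ s)
    with hG
  have hGm : Measurable G := hmeas.indicator measurableSet_ball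
  have hmap : ∫⁻ x, G (R • x) = ENNReal.ofReal ((R ^ n)⁻¹) * ∫⁻ x, G x := by
    rw [← lintegral_map hGm (measurable_const_smul R),
      Measure.map_addHaar_smul _ hR.ne', lintegral_smul_measure, finrank_euclideanSpace_fin,
      abs_of_pos (by positivity), smul_eq_mul]
  have hscale : ∀ x, G (R • x) = ENNReal.ofReal (R ^ s) *
      (ball (0 : EuclideanSpace ℝ (Fin n)) 1).indicator
        (fun x => ENNReal.ofReal (‖x‖ ^ s)) x := by
    intro x
    have hmem : R • x ∈ ball (0 : EuclideanSpace ℝ (Fin n)) R ↔ x ∈ ball 0 1 := by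
      simp [norm_smul, abs_of_pos hR, hR]
    by_cases hx : x ∈ ball (0 : EuclideanSpace ℝ (Fin n)) 1
    · rw [hG, Set.indicator_of_mem (hmem.2 hx), Set.indicator_of_mem hx, norm_smul,
        Real.norm_of_nonneg hR.le, Real.mul_rpow hR.le (norm_nonneg _),
        ENNReal.ofReal_mul (by positivity)]
    · rw [hG, Set.indicator_of_notMem (mt hmem.1 hx), Set.indicator_of_notMem hx, mul_zero]
  simp_rw [hscale] at hmap
  rw [lintegral_const_mul _ (hmeas.indicator measurableSet_ball),
    lintegral_indicator measurableSet_ball, hG, lintegral_indicator measurableSet_ball] at hmap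
  have hRn : ENNReal.ofReal (R ^ n) * ENNReal.ofReal ((R ^ n)⁻¹) = 1 := by
    rw [← ENNReal.ofReal_mul (by positivity), mul_inv_cancel₀ (by positivity), ENNReal.ofReal_one]
  rw [Real.rpow_add hR, Real.rpow_natCast, ENNReal.ofReal_mul (by positivity), mul_assoc, hmap,
    ← mul_assoc, hRn, one_mul]

lemma exists_lintegral_norm_rpow_le (n : ℕ) (hn : 1 ≤ n) {β : ℝ} (hβ : 0 < β) (hβn : β < n) :
    ∃ C : ℝ≥0∞, C ≠ ⊤ ∧ ∀ (y : EuclideanSpace ℝ (Fin n)) (r : ℝ), 0 < r →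
      ENNReal.ofReal (r ^ (-β)) * ∫⁻ x in ball y r, ENNReal.ofReal (‖x‖ ^ (β - n)) ≤ C := by
  set K := ∫⁻ x in ball (0 : EuclideanSpace ℝ (Fin n)) 1, ENNReal.ofReal (‖x‖ ^ (β - n)) with hK
  set V := volume (ball (0 : EuclideanSpace ℝ (Fin n)) 1)
  have hK_top : K ≠ ⊤ := by
    have hint : IntegrableOn (fun x : EuclideanSpace ℝ (Fin n) => ‖x‖ ^ (β - n)) (ball 0 1) := by
      refine integrableOn_ball_of_norm_le_rpow (C := 1) (α := n - β) ?_ ?_ ?_ ?_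
      · simpa using hn
      · simpa using hβ
      · refine Eventually.of_forall fun x => ?_
        rw [Real.norm_of_nonneg (by positivity), one_mul, neg_sub]
      · exact (by fun_prop : Measurable _).aestronglyMeasurable
    exact hint.lintegral_lt_top.ne
  refine ⟨V + ENNReal.ofReal (3 ^ β) * K, ?_, fun y r hr => ?_⟩
  · exact ENNReal.add_ne_top.2 ⟨measure_ball_lt_top.ne,
      ENNReal.mul_ne_top ENNReal.ofReal_ne_top hK_top⟩
  rcases le_or_gt (2 * r) ‖y‖ with hy | hy
  · refine le_trans ?_ le_self_add
    calc _ ≤ ENNReal.ofReal (r ^ (-β)) * ∫⁻ _ in ball y r, ENNReal.ofReal (r ^ (β - n)) := by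
          gcongr ENNReal.ofReal _ * ?_
          refine setLIntegral_mono' measurableSet_ball fun x hx => ?_
          refine ENNReal.ofReal_le_ofReal (Real.rpow_le_rpow_of_nonpos hr ?_ (by linarith))
          rw [mem_ball, dist_eq_norm, norm_sub_rev] at hx
          have := norm_sub_norm_le y x
          linarith
      _ = V := by
          rw [setLIntegral_const, mul_left_comm, ofReal_rpow_neg_mul_volume_ball n β y hr,
            ← mul_assoc, ← ENNReal.ofReal_mul (by positivity), ← Real.rpow_add hr]
          simp [V]
  · refine le_trans ?_ le_add_self
    calc _ ≤ ENNReal.ofReal (r ^ (-β)) *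
          ∫⁻ x in ball (0 : EuclideanSpace ℝ (Fin n)) (3 * r), ENNReal.ofReal (‖x‖ ^ (β - n)) := by
          gcongr ENNReal.ofReal _ * ?_
          refine lintegral_mono_set (ball_subset_ball' ?_)
          rw [dist_zero_right]
          linarith
      _ = ENNReal.ofReal (3 ^ β) * K := by
          rw [lintegral_ball_zero_norm_rpow n _ (by positivity), ← mul_assoc,
            ← ENNReal.ofReal_mul (by positivity), add_sub_cancel,
            Real.mul_rpow (by norm_num) hr.le, mul_left_comm, ← Real.rpow_add hr]
          simp [hK]

lemma le_morreyA_of_norm_rpow_le {n : ℕ} {p β : ℝ} (hβn : β < n)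
    {f : EuclideanSpace ℝ (Fin n) → ℂ} {e : EuclideanSpace ℝ (Fin n)} (he : ‖e‖ = 1) {r : ℝ}
    (hr : 0 < r) (hf : ∀ x, r ≤ ‖x‖ → ENNReal.ofReal (‖x‖ ^ (β - n)) ≤ (‖f x‖₊ : ℝ≥0∞) ^ p) :
    ENNReal.ofReal (3 ^ (β - n)) * volume (ball (0 : EuclideanSpace ℝ (Fin n)) 1) ≤
      morreyA n p β f ((2 * r) • e) r := by
  have hy : ‖(2 * r) • e‖ = 2 * r := by
    rw [norm_smul, he, mul_one, Real.norm_of_nonneg (by positivity)]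
  calc _ = ENNReal.ofReal (r ^ (-β)) *
        ∫⁻ _ in ball ((2 * r) • e) r, ENNReal.ofReal ((3 * r) ^ (β - n)) := by
        rw [setLIntegral_const, mul_left_comm, ofReal_rpow_neg_mul_volume_ball n β _ hr,
          ← mul_assoc, ← ENNReal.ofReal_mul (by positivity), Real.mul_rpow (by norm_num) hr.le,
          mul_assoc, ← Real.rpow_add hr]
        simp
    _ ≤ morreyA n p β f ((2 * r) • e) r := by
        rw [morreyA]
        gcongr ENNReal.ofReal _ * ?_
        refine setLIntegral_mono' measurableSet_ball fun x hx => ?_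
        rw [mem_ball, dist_eq_norm] at hx
        have h1 := norm_sub_norm_le ((2 * r) • e) x
        have h2 := norm_sub_norm_le x ((2 * r) • e)
        rw [norm_sub_rev] at h1
        refine le_trans (ENNReal.ofReal_le_ofReal ?_) (hf x (by linarith))
        exact Real.rpow_le_rpow_of_nonpos (by linarith) (by linarith) (by linarith)

/-- The extremal power function `‖x‖ ^ ((β - n) / p)` of the Morrey space `L^{p,β}`. -/
noncomputable def morreyPower (n : ℕ) (p β : ℝ) (x : EuclideanSpace ℝ (Fin n)) : ℂ :=
  ((‖x‖ ^ ((β - n) / p) : ℝ) : ℂ)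

lemma measurable_morreyPower (n : ℕ) (p β : ℝ) : Measurable (morreyPower n p β) :=
  Complex.measurable_ofReal.comp (by fun_prop)

lemma nnnorm_morreyPower_rpow (n : ℕ) {p : ℝ} (hp : 0 < p) (β : ℝ)
    (x : EuclideanSpace ℝ (Fin n)) :
    (‖morreyPower n p β x‖₊ : ℝ≥0∞) ^ p = ENNReal.ofReal (‖x‖ ^ (β - n)) := by
  rw [← enorm_eq_nnnorm, ← ofReal_norm, morreyPower, Complex.norm_real,
    Real.norm_of_nonneg (by positivity), ENNReal.ofReal_rpow_of_nonneg (by positivity) hp.le,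
    ← Real.rpow_mul (norm_nonneg _), div_mul_cancel₀ _ hp.ne']

lemma volume_ball_zero_one_pos (n : ℕ) :
    0 < volume (ball (0 : EuclideanSpace ℝ (Fin n)) 1) :=
  measure_ball_pos _ _ one_pos

lemma exists_morrey_not_vanishAtOrigin (n : ℕ) (hn : 1 ≤ n) {p β : ℝ} (hp : 1 ≤ p) (hβ : 0 < β)
    (hβn : β < n) : ∃ f ∈ MorreySet n p β, ¬ vanishAtOrigin n p β f := by
  obtain ⟨C, hC, hle⟩ := exists_lintegral_norm_rpow_le n hn hβ hβn
  have hp0 : 0 < p := by linarith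
  refine ⟨morreyPower n p β, ⟨measurable_morreyPower n p β, ?_⟩, fun h => ?_⟩
  · refine morreyNorm_lt_top hp0.le hC fun y r hr => ?_
    simpa only [morreyA, nnnorm_morreyPower_rpow n hp0] using hle y r hr
  · set c := ENNReal.ofReal (3 ^ (β - n)) * volume (ball (0 : EuclideanSpace ℝ (Fin n)) 1)
    have hcpos : 0 < c :=
      ENNReal.mul_pos (ENNReal.ofReal_pos.2 (by positivity)).ne' (volume_ball_zero_one_pos n).ne'
    obtain ⟨t, hlt, ht⟩ := ((h.eventually_lt_const hcpos).and self_mem_nhdsWithin).exists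
    refine hlt.not_ge ((le_morreyA_of_norm_rpow_le (p := p) (f := morreyPower n p β) hβn
      (e := EuclideanSpace.single ⟨0, hn⟩ 1) (by simp) ht
      fun x _ => (nnnorm_morreyPower_rpow n hp0 β x).ge).trans ?_)
    exact le_iSup_of_le _ (le_iSup_of_le t (le_iSup_of_le ht (le_iSup_of_le le_rfl le_rfl)))

lemma exists_vanishAtOrigin_not_vanishAtInfinity (n : ℕ) (hn : 1 ≤ n) {p β : ℝ} (hp : 1 ≤ p)
    (hβ : 0 < β) (hβn : β < n) :
    ∃ f ∈ MorreySet n p β, vanishAtOrigin n p β f ∧ ¬ vanishAtInfinity n p β f := by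
  obtain ⟨C, hC, hle⟩ := exists_lintegral_norm_rpow_le n hn hβ hβn
  have hp0 : 0 < p := by linarith
  set s := {x : EuclideanSpace ℝ (Fin n) | 1 ≤ ‖x‖}
  have hs : MeasurableSet s := measurableSet_le measurable_const measurable_norm
  refine ⟨s.indicator (morreyPower n p β), ⟨(measurable_morreyPower n p β).indicator hs, ?_⟩,
    ?_, fun h => ?_⟩
  · refine morreyNorm_lt_top hp0.le hC fun y r hr => ?_
    refine le_trans ?_ (hle y r hr)
    rw [morreyA]
    gcongr with x
    rw [← nnnorm_morreyPower_rpow n hp0]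
    gcongr
    exact norm_indicator_le_norm_self _ _
  · refine vanishAtOrigin_of_norm_le_one hp0.le hβn fun x => ?_
    by_cases hx : x ∈ s
    · rw [Set.indicator_of_mem hx, morreyPower, Complex.norm_real,
        Real.norm_of_nonneg (by positivity)]
      exact Real.rpow_le_one_of_one_le_of_nonpos hx
        (div_nonpos_of_nonpos_of_nonneg (by linarith) hp0.le)
    · simp [Set.indicator_of_notMem hx]
  · set c := ENNReal.ofReal (3 ^ (β - n)) * volume (ball (0 : EuclideanSpace ℝ (Fin n)) 1)
    have hcpos : 0 < c :=
      ENNReal.mul_pos (ENNReal.ofReal_pos.2 (by positivity)).ne' (volume_ball_zero_one_pos n).ne'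
    obtain ⟨t, hlt, ht⟩ := ((h.eventually_lt_const hcpos).and (eventually_ge_atTop 1)).exists
    refine hlt.not_ge ((le_morreyA_of_norm_rpow_le (p := p)
      (f := s.indicator (morreyPower n p β)) hβn
      (e := EuclideanSpace.single ⟨0, hn⟩ 1) (by simp) (r := t) (by linarith)
      fun x hx => ?_).trans ?_)
    · have hxs : x ∈ s := ht.trans hx
      rw [Set.indicator_of_mem hxs, nnnorm_morreyPower_rpow n hp0]
    · exact le_iSup_of_le _ (le_iSup_of_le t (le_iSup_of_le le_rfl le_rfl))

/-- The union of the unit balls centred at the points `2 ^ k • e`. -/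
def lacunaryBalls {n : ℕ} (e : EuclideanSpace ℝ (Fin n)) : Set (EuclideanSpace ℝ (Fin n)) :=
  ⋃ k : ℕ, ball ((2 : ℝ) ^ k • e) 1

lemma natCast_le_of_two_pow_le {b : ℝ} (hb : 0 < b) {r : ℝ} (hr : 1 ≤ r) {k : ℕ}
    (hk : (2 : ℝ) ^ k ≤ 8 * r) : (k : ℝ) ≤ 2 * 8 ^ b / b * r ^ b := by
  have h1 : k * Real.log 2 ≤ Real.log (8 * r) := by
    rw [← Real.log_pow]
    exact Real.log_le_log (by positivity) hk
  have h2 := Real.log_le_rpow_div (x := 8 * r) (by positivity) hb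
  rw [Real.mul_rpow (by norm_num) (by linarith)] at h2
  have h3 := Real.log_two_gt_d9
  have h4 : (k : ℝ) * (1 / 2) ≤ k * Real.log 2 := by gcongr; linarith
  calc (k : ℝ) ≤ 2 * (8 ^ b * r ^ b / b) := by linarith
    _ = _ := by ring

lemma two_pow_le_of_dist_lt {n : ℕ} {e y : EuclideanSpace ℝ (Fin n)} (he : ‖e‖ = 1) {r : ℝ}
    (hr : 1 ≤ r) {j k : ℕ} (hjk : j < k) (hj : (ball ((2 : ℝ) ^ j • e) 1 ∩ ball y r).Nonempty)
    (hk : (ball ((2 : ℝ) ^ k • e) 1 ∩ ball y r).Nonempty) : (2 : ℝ) ^ k ≤ 8 * r := by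
  obtain ⟨u, hu, hu'⟩ := hj
  obtain ⟨v, hv, hv'⟩ := hk
  rw [mem_ball] at hu hu' hv hv'
  have hd : dist ((2 : ℝ) ^ k • e) ((2 : ℝ) ^ j • e) = 2 ^ k - 2 ^ j := by
    have : (2 : ℝ) ^ j ≤ 2 ^ k := pow_le_pow_right₀ (by norm_num) hjk.le
    rw [dist_eq_norm, ← sub_smul, norm_smul, he, mul_one, Real.norm_of_nonneg (by linarith)]
  have hhalf : 2 * (2 : ℝ) ^ j ≤ 2 ^ k := by
    rw [← pow_succ']
    exact pow_le_pow_right₀ (by norm_num) hjk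
  have h1 := dist_triangle4 ((2 : ℝ) ^ k • e) v u ((2 : ℝ) ^ j • e)
  have h2 := dist_triangle_right v u y
  rw [dist_comm _ v] at h1
  linarith

lemma volume_lacunaryBalls_inter_ball_le {n : ℕ} {e : EuclideanSpace ℝ (Fin n)} (he : ‖e‖ = 1)
    {b : ℝ} (hb : 0 < b) (y : EuclideanSpace ℝ (Fin n)) {r : ℝ} (hr : 1 ≤ r) :
    volume (lacunaryBalls e ∩ ball y r) ≤ ENNReal.ofReal (r ^ b) *
      (ENNReal.ofReal (2 + 2 * 8 ^ b / b) * volume (ball (0 : EuclideanSpace ℝ (Fin n)) 1)) := by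
  classical
  set V := volume (ball (0 : EuclideanSpace ℝ (Fin n)) 1)
  by_cases hex : ∃ k : ℕ, (ball ((2 : ℝ) ^ k • e) 1 ∩ ball y r).Nonempty
  swap
  · have : lacunaryBalls e ∩ ball y r = ∅ := by
      rw [lacunaryBalls, Set.iUnion_inter, Set.iUnion_eq_empty]
      exact fun k => Set.not_nonempty_iff_eq_empty.1 fun h => hex ⟨k, h⟩
    simp [this]
  set j := Nat.find hex
  set M := ⌊2 * 8 ^ b / b * r ^ b⌋₊
  have hsub : lacunaryBalls e ∩ ball y r ⊆
      ⋃ k ∈ insert j (Finset.range (M + 1)), ball ((2 : ℝ) ^ k • e) 1 := by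
    rintro x ⟨hx, hxy⟩
    obtain ⟨k, hk⟩ := Set.mem_iUnion.1 hx
    have hkn : (ball ((2 : ℝ) ^ k • e) 1 ∩ ball y r).Nonempty := ⟨x, hk, hxy⟩
    refine Set.mem_biUnion ?_ hk
    rcases (Nat.find_min' hex hkn).eq_or_lt with h | h
    · exact Finset.mem_coe.2 (Finset.mem_insert.2 (Or.inl h.symm))
    · refine Finset.mem_coe.2 (Finset.mem_insert_of_mem (Finset.mem_range_succ_iff.2 ?_))
      exact Nat.le_floor (natCast_le_of_two_pow_le hb hr
        (two_pow_le_of_dist_lt he hr h (Nat.find_spec hex) hkn))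
  have hcard : ((insert j (Finset.range (M + 1))).card : ℝ) ≤ r ^ b * (2 + 2 * 8 ^ b / b) := by
    have h1 : (insert j (Finset.range (M + 1))).card ≤ M + 2 := by
      simpa using Finset.card_insert_le j (Finset.range (M + 1))
    have h2 : (M : ℝ) ≤ 2 * 8 ^ b / b * r ^ b := Nat.floor_le (by positivity)
    have h3 : 1 ≤ r ^ b := Real.one_le_rpow hr hb.le
    have h4 : ((insert j (Finset.range (M + 1))).card : ℝ) ≤ M + 2 := by exact_mod_cast h1
    linarith
  calc volume (lacunaryBalls e ∩ ball y r)
      ≤ ∑ k ∈ insert j (Finset.range (M + 1)), volume (ball ((2 : ℝ) ^ k • e) 1) :=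
        (measure_mono hsub).trans (measure_biUnion_finset_le _ _)
    _ = ENNReal.ofReal ((insert j (Finset.range (M + 1))).card) * V := by
        simp_rw [Measure.addHaar_ball_center]
        rw [Finset.sum_const, nsmul_eq_mul, ENNReal.ofReal_natCast]
    _ ≤ ENNReal.ofReal (r ^ b * (2 + 2 * 8 ^ b / b)) * V := by gcongr
    _ = _ := by rw [ENNReal.ofReal_mul (by positivity), mul_assoc]

lemma nnnorm_indicator_one_rpow {α : Type*} (s : Set α) {p : ℝ} (hp : 0 < p) (x : α) :
    (‖s.indicator (1 : α → ℂ) x‖₊ : ℝ≥0∞) ^ p = s.indicator 1 x := by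
  by_cases hx : x ∈ s <;> simp [hx, hp]

lemma exists_vanishAtOrigin_vanishAtInfinity_not_vanishTrunc (n : ℕ) (hn : 1 ≤ n) {p β : ℝ}
    (hp : 1 ≤ p) (hβ : 0 < β) (hβn : β < n) :
    ∃ f ∈ MorreySet n p β, vanishAtOrigin n p β f ∧ vanishAtInfinity n p β f ∧
      ¬ vanishTrunc n p β f := by
  have hp0 : 0 < p := by linarith
  set e : EuclideanSpace ℝ (Fin n) := EuclideanSpace.single ⟨0, hn⟩ 1
  have he : ‖e‖ = 1 := by simp [e]
  set V := volume (ball (0 : EuclideanSpace ℝ (Fin n)) 1)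
  have hVtop : V ≠ ⊤ := measure_ball_lt_top.ne
  set s := lacunaryBalls e
  have hs : MeasurableSet s := (isOpen_iUnion fun _ => isOpen_ball).measurableSet
  set f : EuclideanSpace ℝ (Fin n) → ℂ := s.indicator 1
  have hf1 : ∀ x, ‖f x‖ ≤ 1 := fun x =>
    (norm_indicator_le_norm_self _ _).trans (by simp)
  have hfint : ∀ t : Set (EuclideanSpace ℝ (Fin n)),
      ∫⁻ x in t, (‖f x‖₊ : ℝ≥0∞) ^ p = volume (s ∩ t) := by
    intro t
    simp_rw [f, nnnorm_indicator_one_rpow s hp0]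
    rw [lintegral_indicator_one hs, Measure.restrict_apply hs]
  have hgrowth (b : ℝ) (hb : 0 < b) (y : EuclideanSpace ℝ (Fin n)) (r : ℝ) (hr : 1 ≤ r) :
      ∫⁻ x in ball y r, (‖f x‖₊ : ℝ≥0∞) ^ p ≤
        ENNReal.ofReal (r ^ b) * (ENNReal.ofReal (2 + 2 * 8 ^ b / b) * V) := by
    rw [hfint]
    exact volume_lacunaryBalls_inter_ball_le he hb y hr
  refine ⟨f, ⟨measurable_one.indicator hs, ?_⟩, vanishAtOrigin_of_norm_le_one hp0.le hβn hf1,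
    vanishAtInfinity_of_lintegral_le (half_lt_self hβ)
      (ENNReal.mul_ne_top ENNReal.ofReal_ne_top hVtop) (hgrowth (β / 2) (half_pos hβ)),
    fun h => ?_⟩
  · refine morreyNorm_lt_top hp0.le (C := V + ENNReal.ofReal (2 + 2 * 8 ^ β / β) * V)
      (ENNReal.add_ne_top.2 ⟨hVtop, ENNReal.mul_ne_top ENNReal.ofReal_ne_top hVtop⟩)
      fun y r hr => ?_
    rcases le_total r 1 with hr1 | hr1
    · refine (morreyA_le_of_norm_le_one hp0.le hf1 y hr).trans (le_trans ?_ le_self_add)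
      refine mul_le_of_le_one_left zero_le (ENNReal.ofReal_le_one.2 ?_)
      exact Real.rpow_le_one hr.le hr1 (by linarith)
    · refine le_trans ?_ le_add_self
      refine (mul_le_mul_right (hgrowth β hβ y r hr1) _).trans_eq ?_
      rw [← mul_assoc, ← ENNReal.ofReal_mul (by positivity), ← Real.rpow_add hr]
      simp
  · obtain ⟨N, hN⟩ := (h.eventually_lt_const (volume_ball_zero_one_pos n)).exists
    obtain ⟨k, hk⟩ := pow_unbounded_of_one_lt (N + 1) (one_lt_two (α := ℝ))
    refine hN.not_ge (le_iSup_of_le ((2 : ℝ) ^ k • e)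
      (le_iSup_of_le 1 (le_iSup_of_le one_pos ?_)))
    rw [hfint, Real.one_rpow, ENNReal.ofReal_one, one_mul,
      ← Measure.addHaar_ball_center volume ((2 : ℝ) ^ k • e) 1]
    refine measure_mono fun x hx => ⟨Set.mem_iUnion.2 ⟨k, hx⟩, hx, ?_⟩
    rw [mem_ball, dist_eq_norm, norm_sub_rev] at hx
    have h1 := norm_sub_norm_le ((2 : ℝ) ^ k • e) x
    rw [norm_smul, he, mul_one, Real.norm_of_nonneg (by positivity)] at h1
    change N < ‖x‖
    linarith

/-- The strict chain of inclusions
`L^{p,β}_{0,∞,*} ⊊ L^{p,β}_0 ∩ L^{p,β}_∞ ⊊ L^{p,β}_0 ⊊ L^{p,β}`. -/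
theorem morrey_subspaces_strict_chain (n : ℕ) (hn : 1 ≤ n) (p β : ℝ)
    (hp : 1 ≤ p) (hβ : 0 < β) (hβn : β < n) :
    (MorreySet n p β ∩ {f | vanishAtOrigin n p β f} ∩ {f | vanishAtInfinity n p β f}
        ∩ {f | vanishTrunc n p β f})
      ⊂ (MorreySet n p β ∩ {f | vanishAtOrigin n p β f} ∩ {f | vanishAtInfinity n p β f}) ∧
    (MorreySet n p β ∩ {f | vanishAtOrigin n p β f} ∩ {f | vanishAtInfinity n p β f})
      ⊂ (MorreySet n p β ∩ {f | vanishAtOrigin n p β f}) ∧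
    (MorreySet n p β ∩ {f | vanishAtOrigin n p β f}) ⊂ MorreySet n p β := by
  refine ⟨⟨Set.inter_subset_left, fun h => ?_⟩, ⟨Set.inter_subset_left, fun h => ?_⟩,
    ⟨Set.inter_subset_left, fun h => ?_⟩⟩
  · obtain ⟨f, hf, h0, hi, ht⟩ :=
      exists_vanishAtOrigin_vanishAtInfinity_not_vanishTrunc n hn hp hβ hβn
    exact ht (h ⟨⟨hf, h0⟩, hi⟩).2
  · obtain ⟨f, hf, h0, hi⟩ := exists_vanishAtOrigin_not_vanishAtInfinity n hn hp hβ hβn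
    exact hi (h ⟨hf, h0⟩).2
  · obtain ⟨f, hf, h0⟩ := exists_morrey_not_vanishAtOrigin n hn hp hβ hβn
    exact h0 (h hf).2
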